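/- arXiv:2111.02764 — 5 statements merged into one kernel-verified Lean document; each statement's English description precedes it below -/
import Mathlib

section
/- Let K be an n×n complex matrix such that: (i) every eigenvalue λ of K satisfies |1 − λ| ≤ 1; (ii) λ = 0 is the only eigenvalue of K with |1 − λ| = 1; (iii) the algebraic multiplicity of the eigenvalue 0 of K equals its geometric multiplicity. Then for every vector g ∈ ℂⁿ the sequence ((I − K)^m g)_{m∈ℕ} converges as m → ∞, and its limit lies in the kernel (null space) of K; moreover the map P sending g to this limit is linear, satisfies P ∘ P = P, and its range equals the kernel of K. -/
open Filter Topology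

lemma aux_summable {n : ℕ} (a : ℂ) (ha : ‖a‖ < 1) (x e : ℕ → (Fin n → ℂ))
    (he : Summable fun m => ‖e m‖) (hx : ∀ m, x (m+1) = a • x m - e m) :
    Summable fun m => ‖x m‖ := by
  have key : ∀ M, ∑ m ∈ Finset.range M, ‖x m‖ ≤ (‖x 0‖ + ∑' m, ‖e m‖) / (1 - ‖a‖) := by
    intro M
    rw [le_div_iff₀ (by linarith)]
    have h1 : ∑ m ∈ Finset.range (M+1), ‖x m‖ ≤
        ‖a‖ * ∑ m ∈ Finset.range M, ‖x m‖ + ∑ m ∈ Finset.range M, ‖e m‖ + ‖x 0‖ := by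
      rw [Finset.sum_range_succ', Finset.mul_sum, ← Finset.sum_add_distrib]
      gcongr with m hm
      rw [hx]
      exact (norm_sub_le _ _).trans (by rw [norm_smul])
    have h2 : ∑ m ∈ Finset.range M, ‖e m‖ ≤ ∑' m, ‖e m‖ :=
      he.sum_le_tsum _ (fun _ _ => norm_nonneg _)
    rw [Finset.sum_range_succ] at h1
    have := norm_nonneg (x M)
    linarith
  exact summable_of_sum_range_le (fun _ => norm_nonneg _) key

lemma aux_gen {n : ℕ} (f : Module.End ℂ (Fin n → ℂ)) (μ : ℂ) (hμ : ‖1 - μ‖ < 1) (k : ℕ) :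
    ∀ g, ((f - algebraMap ℂ _ μ) ^ k) g = 0 → Summable fun m : ℕ => ‖((1 - f) ^ m) g‖ := by
  induction k with
  | zero =>
    intro g hg
    have : g = 0 := by simpa using hg
    subst this
    simpa using summable_zero
  | succ k ih =>
    intro g hg
    rw [pow_succ, Module.End.mul_apply] at hg
    refine aux_summable (1 - μ) hμ _ _ (ih _ hg) ?_
    intro m
    rw [pow_succ, Module.End.mul_apply, ← map_smul, ← map_sub]
    congr 1
    simp [sub_smul, Module.algebraMap_end_apply]

theorem stmt_1 (n : ℕ) (K : Matrix (Fin n) (Fin n) ℂ)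
    (h1 : ∀ lam : ℂ, (∃ v : Fin n → ℂ, v ≠ 0 ∧ K.mulVec v = lam • v) →
      ‖1 - lam‖ ≤ 1)
    (h2 : ∀ lam : ℂ, (∃ v : Fin n → ℂ, v ≠ 0 ∧ K.mulVec v = lam • v) →
      ‖1 - lam‖ = 1 → lam = 0)
    (h3 : (Matrix.charpoly K).rootMultiplicity 0 =
      Module.finrank ℂ (LinearMap.ker K.mulVecLin)) :
    ∃ P : (Fin n → ℂ) →ₗ[ℂ] (Fin n → ℂ),
      (∀ g : Fin n → ℂ,
        Tendsto (fun m : ℕ => ((1 - K) ^ m).mulVec g) atTop (𝓝 (P g))) ∧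
      (∀ g : Fin n → ℂ, P g ∈ LinearMap.ker K.mulVecLin) ∧
      P ∘ₗ P = P ∧
      LinearMap.range P = LinearMap.ker K.mulVecLin := by
  set f : Module.End ℂ (Fin n → ℂ) := K.mulVecLin with hf
  have hpow : ∀ (m : ℕ) g, ((1 - K) ^ m).mulVec g = ((1 - f) ^ m) g := by
    intro m
    induction m with
    | zero => intro g; simp
    | succ m ih =>
      intro g
      rw [pow_succ, pow_succ, ← Matrix.mulVec_mulVec, ih, Module.End.mul_apply]
      congr 1
      simp [hf, Matrix.sub_mulVec]
  simp only [hpow]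
  have hker : f.maxGenEigenspace 0 = LinearMap.ker f := by
    symm
    apply Submodule.eq_of_le_of_finrank_eq
    · rw [← Module.End.eigenspace_zero]
      exact f.genEigenspace_le_maximal 0 1
    · rw [LinearMap.finrank_maxGenEigenspace_eq, ← h3, hf, ← Matrix.toLin'_apply',
        Matrix.charpoly_toLin']
  have hfix : ∀ g ∈ LinearMap.ker f, ∀ m : ℕ, ((1 - f) ^ m) g = g := by
    intro g hg m
    have hg' : f g = 0 := hg
    induction m with
    | zero => simp
    | succ m ih => rw [pow_succ, Module.End.mul_apply]; simp [hg', ih]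
  let S : Submodule ℂ (Fin n → ℂ) :=
    { carrier := {g | ∃ l, Tendsto (fun m : ℕ => ((1 - f) ^ m) g) atTop (𝓝 l)}
      zero_mem' := ⟨0, by simp⟩
      add_mem' := by
        rintro a b ⟨l, hl⟩ ⟨l', hl'⟩
        exact ⟨l + l', by simpa using hl.add hl'⟩
      smul_mem' := by
        rintro c a ⟨l, hl⟩
        exact ⟨c • l, by simpa using hl.const_smul c⟩ }
  have hS : S = ⊤ := by
    rw [eq_top_iff, ← Module.End.iSup_maxGenEigenspace_eq_top f]
    refine iSup_le fun μ => ?_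
    intro g hg
    by_cases hμ0 : μ = 0
    · subst hμ0
      rw [hker] at hg
      exact ⟨g, by simp only [hfix g hg]; exact tendsto_const_nhds⟩
    by_cases he : f.HasEigenvalue μ
    · obtain ⟨v, hv⟩ := he.exists_hasEigenvector
      have hv' : ∃ v : Fin n → ℂ, v ≠ 0 ∧ K.mulVec v = μ • v := ⟨v, hv.2, hv.apply_eq_smul⟩
      have hlt : ‖1 - μ‖ < 1 := lt_of_le_of_ne (h1 μ hv') fun h => hμ0 (h2 μ hv' h)
      rw [Module.End.mem_maxGenEigenspace] at hg
      obtain ⟨k, hk⟩ := hg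
      have := aux_gen f μ hlt k g (by rwa [Algebra.algebraMap_eq_smul_one])
      exact ⟨0, tendsto_zero_iff_norm_tendsto_zero.2 this.tendsto_atTop_zero⟩
    · have : f.maxGenEigenspace μ = ⊥ := by
        by_contra hne
        apply he
        rw [Module.End.mem_maxGenEigenspace] at hg
        rw [Module.End.maxGenEigenspace_eq] at hne
        exact Module.End.hasEigenvalue_of_hasGenEigenvalue hne
      rw [this, Submodule.mem_bot] at hg
      subst hg
      exact S.zero_mem
  have hlim : ∀ g, ∃ l, Tendsto (fun m : ℕ => ((1 - f) ^ m) g) atTop (𝓝 l) := by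
    intro g
    have : g ∈ S := by rw [hS]; trivial
    exact this
  choose p hp using hlim
  let P : (Fin n → ℂ) →ₗ[ℂ] (Fin n → ℂ) :=
    { toFun := p
      map_add' := fun a b => tendsto_nhds_unique (hp _) (by simpa using (hp a).add (hp b))
      map_smul' := fun c a =>
        tendsto_nhds_unique (hp _) (by simpa using (hp a).const_smul c) }
  have hPker : ∀ g, P g ∈ LinearMap.ker f := by
    intro g
    have hc : Continuous (1 - f : Module.End ℂ (Fin n → ℂ)) :=
      LinearMap.continuous_of_finiteDimensional _
    have ha := (hc.tendsto (p g)).comp (hp g)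
    have hb := (hp g).comp (tendsto_add_atTop_nat 1)
    have hh : (1 - f) (p g) = p g := by
      refine tendsto_nhds_unique ha (hb.congr fun m => ?_)
      simp only [Function.comp_apply]
      rw [pow_succ', Module.End.mul_apply]
    have : f (p g) = 0 := by simpa using hh
    exact this
  have hPfix : ∀ g ∈ LinearMap.ker f, P g = g := by
    intro g hg
    refine tendsto_nhds_unique (hp g) ?_
    simp only [hfix g hg]
    exact tendsto_const_nhds
  refine ⟨P, hp, hPker, ?_, ?_⟩
  · ext1 g
    exact LinearMap.ext fun x => hPfix _ (hPker _) |> fun h => by simpa using h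
  · apply le_antisymm
    · rintro _ ⟨g, rfl⟩
      exact hPker g
    · intro g hg
      exact ⟨g, hPfix g hg⟩
end

section
/- Let K be an n×n real matrix with operator 2-norm ‖K‖ ≤ 1. Then for every g ∈ ℝⁿ, the sequence ((I − KᵀK)^m g)_{m∈ℕ} converges as m → ∞, and its limit equals the orthogonal projection of g onto the kernel of K. -/
open Filter Topology Matrix

lemma salif_eig (n : ℕ) (K : Matrix (Fin n) (Fin n) ℝ)
    (hK : ∀ v : Fin n → ℝ, ∑ i : Fin n, (K.mulVec v i) ^ 2 ≤ ∑ i : Fin n, (v i) ^ 2)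
    (v : Fin n → ℝ) (l : ℝ) (hv : (Kᵀ * K).mulVec v = l • v) :
    ∃ p : Fin n → ℝ,
      K.mulVec p = 0 ∧
      (∀ w : Fin n → ℝ, K.mulVec w = 0 → (v - p) ⬝ᵥ w = 0) ∧
      Tendsto (fun m : ℕ => ((1 - Kᵀ * K) ^ m).mulVec v) atTop (𝓝 p) := by
  have hpow : ∀ m : ℕ, ((1 - Kᵀ * K) ^ m).mulVec v = (1 - l) ^ m • v := by
    intro m
    induction m with
    | zero => simp
    | succ m ih =>
      rw [pow_succ, ← Matrix.mulVec_mulVec, Matrix.sub_mulVec, hv, Matrix.one_mulVec,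
        show v - l • v = (1 - l) • v by rw [sub_smul, one_smul],
        Matrix.mulVec_smul, ih, smul_smul, pow_succ, mul_comm]
  have hdot : ∀ w : Fin n → ℝ, l * (v ⬝ᵥ w) = K.mulVec v ⬝ᵥ K.mulVec w := by
    intro w
    rw [← smul_eq_mul, ← smul_dotProduct, ← hv, ← Matrix.mulVec_mulVec, Matrix.mulVec_transpose,
      Matrix.dotProduct_mulVec]
  have hsq : ∀ u : Fin n → ℝ, ∑ i, u i ^ 2 = u ⬝ᵥ u := by
    intro u; simp [dotProduct, sq]
  have h1 := hK v
  rw [hsq, hsq, ← hdot] at h1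
  have h2 : 0 ≤ l * (v ⬝ᵥ v) := by
    rw [hdot, ← hsq]; positivity
  by_cases hv0 : v = 0
  · subst hv0
    exact ⟨0, by simp, by simp, by simp⟩
  have hpos : 0 < v ⬝ᵥ v := by
    refine lt_of_le_of_ne ?_ (fun h => hv0 (dotProduct_self_eq_zero.1 h.symm))
    rw [← hsq]; positivity
  have hl0 : 0 ≤ l := nonneg_of_mul_nonneg_left h2 hpos
  have hl1 : l ≤ 1 := by
    by_contra h
    push Not at h
    nlinarith
  rcases hl0.eq_or_lt with h | h
  · subst h
    refine ⟨v, ?_, by simp, by simp [hpow]⟩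
    apply dotProduct_self_eq_zero.1
    rw [← hdot]; simp
  · refine ⟨0, by simp, ?_, ?_⟩
    · intro w hw
      have := hdot w
      rw [hw, dotProduct_zero] at this
      simpa [h.ne'] using this
    · simp only [hpow]
      have := (tendsto_pow_atTop_nhds_zero_of_lt_one (r := 1 - l) (by linarith)
        (by linarith)).smul_const v
      simpa using this

/-- SALIF convergence: if `K` is a real matrix with operator 2-norm at most 1
(i.e. `‖Kv‖₂ ≤ ‖v‖₂` for all `v`), then the iterates `(I - KᵀK)^m g` converge, and
the limit is the orthogonal projection of `g` onto the kernel of `K`. -/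
theorem stmt_9 (n : ℕ) (K : Matrix (Fin n) (Fin n) ℝ)
    (hK : ∀ v : Fin n → ℝ, ∑ i : Fin n, (K.mulVec v i) ^ 2 ≤ ∑ i : Fin n, (v i) ^ 2)
    (g : Fin n → ℝ) :
    ∃ p : Fin n → ℝ,
      K.mulVec p = 0 ∧
      (∀ w : Fin n → ℝ, K.mulVec w = 0 → ∑ i : Fin n, (g i - p i) * w i = 0) ∧
      Tendsto (fun m : ℕ => ((1 - Kᵀ * K) ^ m).mulVec g) atTop (𝓝 p) := by
  have hA : (Kᵀ * K).IsHermitian := by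
    simpa using Matrix.isHermitian_conjTranspose_mul_self K
  have key := fun j => salif_eig n K hK (hA.eigenvectorBasis j) (hA.eigenvalues j)
    (hA.mulVec_eigenvectorBasis j)
  choose p hp1 hp2 hp3 using key
  let c : Fin n → ℝ := fun j => hA.eigenvectorBasis.repr (WithLp.toLp 2 g) j
  have hg : g = ∑ j, c j • (hA.eigenvectorBasis j : Fin n → ℝ) := by
    have := hA.eigenvectorBasis.sum_repr (WithLp.toLp 2 g)
    have h2 := congrArg (WithLp.ofLp) this
    simpa [c] using h2.symm
  refine ⟨∑ j, c j • p j, ?_, ?_, ?_⟩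
  · simp [Matrix.mulVec_sum, Matrix.mulVec_smul, hp1]
  · intro w hw
    change (g - ∑ j, c j • p j) ⬝ᵥ w = 0
    rw [hg, ← Finset.sum_sub_distrib, sum_dotProduct]
    refine Finset.sum_eq_zero fun j _ => ?_
    rw [← smul_sub, smul_dotProduct, hp2 j w hw, smul_zero]
  · have : (fun m : ℕ => ((1 - Kᵀ * K) ^ m).mulVec g) = fun m : ℕ =>
        ∑ j, c j • ((1 - Kᵀ * K) ^ m).mulVec (hA.eigenvectorBasis j : Fin n → ℝ) := by
      funext m
      conv_lhs => rw [hg]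
      simp only [Matrix.mulVec_sum, Matrix.mulVec_smul]
    rw [this]
    exact tendsto_finsetSum _ fun j _ => (hp3 j).const_smul (c j)
end

section
/- Let A be an n×n real symmetric positive semidefinite matrix and let D be an n×n real diagonal matrix with strictly positive diagonal entries, and suppose every eigenvalue of A·D is at most 1. Then for every vector g ∈ ℝⁿ, the sequence ((I − A·D)^m g)_{m∈ℕ} converges as m → ∞, and its limit lies in the kernel of A·D. -/
open Filter Topology Matrix

/-- Convergence of the interpolation-free discrete RIF iteration: if `A` is real
symmetric positive semidefinite, `D = diag(d)` with `d i > 0`, and every (complex)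
eigenvalue of `A·D` is at most `1`, then for every `g` the iterates `(I − A·D)^m g`
converge and the limit lies in the kernel of `A·D`. -/
theorem stmt_11 (n : ℕ) (A : Matrix (Fin n) (Fin n) ℝ) (hA : A.PosSemidef)
    (d : Fin n → ℝ) (hd : ∀ i : Fin n, 0 < d i)
    (heig : ∀ (mu : ℂ) (v : Fin n → ℂ), v ≠ 0 →
      ((A * Matrix.diagonal d).map (Complex.ofReal ·)).mulVec v = mu • v → mu.re ≤ 1)
    (g : Fin n → ℝ) :
    ∃ p : Fin n → ℝ,
      Tendsto (fun m : ℕ => ((1 - A * Matrix.diagonal d) ^ m).mulVec g) atTop (𝓝 p) ∧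
      (A * Matrix.diagonal d).mulVec p = 0 := by
  obtain ⟨s, hs, hsd⟩ : ∃ s : Fin n → ℝ, (∀ i, s i ≠ 0) ∧ ∀ i, s i * s i = d i :=
    ⟨fun i => √(d i), fun i => (Real.sqrt_pos.2 (hd i)).ne', fun i => Real.mul_self_sqrt (hd i).le⟩
  have hB : (Matrix.diagonal s * A * Matrix.diagonal s).PosSemidef := by
    have h := hA.mul_mul_conjTranspose_same (Matrix.diagonal s)
    simpa [Matrix.diagonal_conjTranspose] using h
  set B := Matrix.diagonal s * A * Matrix.diagonal s with hBdef
  let b : Fin n → Fin n → ℝ := fun j => (hB.1.eigenvectorBasis j).ofLp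
  let l := hB.1.eigenvalues
  have hb : ∀ j, B *ᵥ b j = l j • b j := fun j => hB.1.mulVec_eigenvectorBasis j
  have hb0 : ∀ j, b j ≠ 0 := by
    intro j h
    apply hB.1.eigenvectorBasis.orthonormal.ne_zero j
    ext i
    exact congrFun h i
  let T : Matrix (Fin n) (Fin n) ℝ := Matrix.diagonal (fun i => (s i)⁻¹)
  have hTS : T * Matrix.diagonal s = 1 := by
    simp [T, hs]
  have hST : Matrix.diagonal s * T = 1 := by
    simp [T, hs]
  have hSS : Matrix.diagonal d = Matrix.diagonal s * Matrix.diagonal s := by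
    simp [hsd]
  let u : Fin n → Fin n → ℝ := fun j => T *ᵥ b j
  have hADT : A * Matrix.diagonal d * T = T * B := by
    calc A * Matrix.diagonal d * T
        = A * Matrix.diagonal s * (Matrix.diagonal s * T) := by
          rw [hSS]; simp only [Matrix.mul_assoc]
      _ = (T * Matrix.diagonal s) * A * Matrix.diagonal s := by rw [hST, hTS]; simp
      _ = T * B := by rw [hBdef]; simp only [Matrix.mul_assoc]
  have hu : ∀ j, (A * Matrix.diagonal d) *ᵥ u j = l j • u j := by
    intro j
    simp only [u]
    rw [Matrix.mulVec_mulVec, hADT, ← Matrix.mulVec_mulVec, hb, Matrix.mulVec_smul]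
  have hu0 : ∀ j, u j ≠ 0 := by
    intro j h
    apply hb0 j
    have h2 : Matrix.diagonal s *ᵥ u j = b j := by
      simp only [u]
      rw [Matrix.mulVec_mulVec, hST, Matrix.one_mulVec]
    rw [← h2, h, Matrix.mulVec_zero]
  have hl0 : ∀ j, 0 ≤ l j := fun j => hB.eigenvalues_nonneg j
  have hl1 : ∀ j, l j ≤ 1 := by
    intro j
    have h := heig (l j : ℂ) (fun i => (u j i : ℂ)) ?_ ?_
    · simpa using h
    · intro h
      apply hu0 j
      ext i
      have := congrFun h i
      simpa using this
    · ext i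
      have := congrFun (hu j) i
      simp only [Matrix.mulVec, dotProduct, Pi.smul_apply, smul_eq_mul, Matrix.map_apply] at this ⊢
      exact_mod_cast congrArg Complex.ofReal this
  obtain ⟨c, hc⟩ : ∃ c : Fin n → ℝ, g = ∑ j, c j • u j := by
    refine ⟨hB.1.eigenvectorBasis.repr (WithLp.toLp 2 (Matrix.diagonal s *ᵥ g)), ?_⟩
    have h := congrArg WithLp.ofLp
      (hB.1.eigenvectorBasis.sum_repr (WithLp.toLp 2 (Matrix.diagonal s *ᵥ g)))
    rw [WithLp.ofLp_sum] at h
    have h2 := congrArg (fun v => T *ᵥ v) h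
    simp only [Matrix.mulVec_mulVec, hTS, Matrix.one_mulVec, Matrix.mulVec_sum,
      WithLp.ofLp_smul, Matrix.mulVec_smul] at h2
    exact h2.symm
  have hpow : ∀ (m : ℕ) j, ((1 - A * Matrix.diagonal d) ^ m) *ᵥ u j = (1 - l j) ^ m • u j := by
    intro m j
    induction m with
    | zero => simp
    | succ m ih =>
      rw [pow_succ, ← Matrix.mulVec_mulVec, Matrix.sub_mulVec, Matrix.one_mulVec, hu,
        Matrix.mulVec_sub, Matrix.mulVec_smul, ih, pow_succ]
      module
  refine ⟨∑ j, c j • (if l j = 0 then (1 : ℝ) else 0) • u j, ?_, ?_⟩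
  · have : (fun m : ℕ => ((1 - A * Matrix.diagonal d) ^ m).mulVec g)
        = fun m => ∑ j, c j • (1 - l j) ^ m • u j := by
      funext m
      rw [hc, Matrix.mulVec_sum]
      simp only [Matrix.mulVec_smul, hpow]
    rw [this]
    refine tendsto_finsetSum _ fun j _ => Tendsto.const_smul (Tendsto.smul_const ?_ _) _
    split_ifs with h
    · have h1 : ∀ m : ℕ, (1 : ℝ) = (1 - l j) ^ m := fun m => by rw [h]; simp
      exact Tendsto.congr h1 tendsto_const_nhds
    · have h0 : 0 < l j := lt_of_le_of_ne (hl0 j) (Ne.symm h)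
      exact tendsto_pow_atTop_nhds_zero_of_lt_one (by linarith [hl1 j]) (by linarith)
  · rw [Matrix.mulVec_sum]
    refine Finset.sum_eq_zero fun j _ => ?_
    rw [Matrix.mulVec_smul, Matrix.mulVec_smul, hu]
    split_ifs with h
    · simp [h]
    · simp
end

section
/- Let M > 0, let G : [0, M] → ℝ be continuously differentiable with G(0) = 0, G(M) = 1 and G'(y) > 0 for all y ∈ [0, M], and let a : [0,1] → ℝ be continuous. Suppose there is a constant β ∈ ℝ such that a(G(y))·G'(y)·M = β for every y ∈ [0, M]. Then β = ∫₀¹ a(t) dt; in particular β ≤ sup_{x ∈ [0,1]} a(x). -/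
open Set intervalIntegral

/-- Anti-aliasing property of the FRIF resampling: if `G : [0,M] → [0,1]` is a `C¹`
increasing resampling with `G(0) = 0`, `G(M) = 1`, and the resampled frequency
`a(G(y))·G'(y)·M` is a constant `β` on `[0,M]`, then `β = ∫₀¹ a(t) dt`; in particular
`β` does not exceed the supremum of `a` on `[0,1]`. -/
theorem stmt_12 (M : ℝ) (hM : 0 < M) (G G' : ℝ → ℝ)
    (hGderiv : ∀ y ∈ Icc (0:ℝ) M, HasDerivWithinAt G (G' y) (Icc 0 M) y)
    (hG'cont : ContinuousOn G' (Icc 0 M))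
    (hG'pos : ∀ y ∈ Icc (0:ℝ) M, 0 < G' y)
    (hG0 : G 0 = 0) (hGM : G M = 1)
    (a : ℝ → ℝ) (ha : ContinuousOn a (Icc 0 1))
    (β : ℝ) (hβ : ∀ y ∈ Icc (0:ℝ) M, a (G y) * G' y * M = β) :
    β = (∫ t in (0:ℝ)..1, a t) ∧ β ≤ sSup (a '' Icc (0:ℝ) 1) := by
  have hc : ContinuousOn G (Icc 0 M) := fun y hy => (hGderiv y hy).continuousWithinAt
  have hd : ∀ x ∈ Ioo (0:ℝ) M, HasDerivAt G (G' x) x := fun x hx =>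
    (hGderiv x (Ioo_subset_Icc_self hx)).hasDerivAt (Icc_mem_nhds hx.1 hx.2)
  have hmono : MonotoneOn G (Icc 0 M) := by
    apply monotoneOn_of_deriv_nonneg (convex_Icc 0 M) hc
    · rw [interior_Icc]
      exact fun x hx => (hd x hx).differentiableAt.differentiableWithinAt
    · rw [interior_Icc]
      intro x hx
      rw [(hd x hx).deriv]
      exact (hG'pos x (Ioo_subset_Icc_self hx)).le
  have himg : G '' Icc 0 M ⊆ Icc 0 1 := by
    rintro _ ⟨y, hy, rfl⟩
    constructor
    · rw [← hG0]; exact hmono ⟨le_rfl, hM.le⟩ hy hy.1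
    · rw [← hGM]; exact hmono hy ⟨hM.le, le_rfl⟩ hy.2
  have hsub : (∫ x in (0:ℝ)..M, (a ∘ G) x * G' x) = ∫ u in G 0..G M, a u := by
    apply integral_comp_mul_deriv''
    · rwa [uIcc_of_le hM.le]
    · rw [min_eq_left hM.le, max_eq_right hM.le]
      exact fun x hx => (hd x hx).hasDerivWithinAt
    · rwa [uIcc_of_le hM.le]
    · rw [uIcc_of_le hM.le]
      exact ha.mono himg
  have hconst : (∫ x in (0:ℝ)..M, (a ∘ G) x * G' x) = ∫ x in (0:ℝ)..M, β / M := by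
    apply integral_congr
    intro x hx
    rw [uIcc_of_le hM.le] at hx
    simp only [Function.comp]
    rw [eq_div_iff hM.ne']
    exact hβ x hx
  have h1 : β = ∫ t in (0:ℝ)..1, a t := by
    rw [hG0, hGM, hconst, integral_const, smul_eq_mul, sub_zero, mul_div_cancel₀ _ hM.ne'] at hsub
    exact hsub
  refine ⟨h1, ?_⟩
  have hb : BddAbove (a '' Icc (0:ℝ) 1) := (isCompact_Icc.image_of_continuousOn ha).bddAbove
  have h2 : (∫ t in (0:ℝ)..1, a t) ≤ ∫ t in (0:ℝ)..1, sSup (a '' Icc (0:ℝ) 1) := by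
    apply integral_mono_on zero_le_one
    · exact ContinuousOn.intervalIntegrable (by rwa [uIcc_of_le zero_le_one])
    · simp
    · exact fun x hx => le_csSup hb ⟨x, hx, rfl⟩
  rw [h1]
  simpa using h2
end

section
/- Let k be a continuous real-valued function on the circle AddCircle 1 = ℝ/ℤ whose Fourier coefficients fourierCoeff k n are, for every n ∈ ℤ, real numbers lying in the interval [0, 1]. Define the operator S on L²(AddCircle 1) by S(g) = g − k ⋆ g, where (k ⋆ g)(x) = ∫ k(t)·g(x − t) dt is periodic convolution. Then for every g ∈ L²(AddCircle 1) the sequence (Sᵐ g)_{m∈ℕ} converges in L² as m → ∞. -/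
open MeasureTheory AddCircle Filter Topology

lemma aux_conv (k g : AddCircle (1 : ℝ) → ℂ) (hk : Integrable k haarAddCircle)
    (hg : Integrable g haarAddCircle) (n : ℤ) :
    Integrable (fun x => ∫ t, k t * g (x - t) ∂haarAddCircle) haarAddCircle ∧
    fourierCoeff (fun x => ∫ t, k t * g (x - t) ∂haarAddCircle) n
      = fourierCoeff k n * fourierCoeff g n := by
  constructor
  · exact hk.integrable_convolution (ContinuousLinearMap.mul ℂ ℂ) hg
  · have h := integral_convolution (ContinuousLinearMap.mul ℂ ℂ) (μ := haarAddCircle)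
      (ν := haarAddCircle) (hk.fourier_smul (-n)) (hg.fourier_smul (-n))
    simp only [fourierCoeff]
    simp only [ContinuousLinearMap.mul_apply'] at h
    rw [← h]
    refine integral_congr_ae (Eventually.of_forall fun x => ?_)
    simp only [convolution, ContinuousLinearMap.mul_apply', smul_eq_mul]
    rw [← integral_const_mul]
    refine integral_congr_ae (Eventually.of_forall fun t => ?_)
    have : (fourier (-n) x : ℂ) = fourier (-n) t * fourier (-n) (x - t) := by
      conv_lhs => rw [show x = t + (x - t) by abel]
      simp only [fourier_apply, smul_add, toCircle_add, Circle.coe_mul]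
    simp only [this]
    ring

lemma aux_lim {a : ℤ → ℝ} (h0 : ∀ n, 0 ≤ a n) (h1 : ∀ n, a n ≤ 1)
    (u : ℕ → lp (fun _ : ℤ => ℂ) 2) (hu : ∀ m n, u m n = (a n : ℂ) ^ m * u 0 n) :
    ∃ v, Tendsto u atTop (𝓝 v) := by
  classical
  have hs : Summable fun n => ‖u 0 n‖ ^ (2 : ℝ) := by
    simpa using (lp.memℓp (u 0)).summable (by norm_num)
  have hmem : Memℓp (fun n => if a n = 1 then u 0 n else 0 : ∀ _ : ℤ, ℂ) 2 := by
    apply memℓp_gen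
    refine Summable.of_nonneg_of_le (fun n => by positivity) (fun n => ?_) hs
    simp only [ENNReal.toReal_ofNat]
    split_ifs
    · exact le_rfl
    · simp
  refine ⟨⟨_, hmem⟩, ?_⟩
  rw [tendsto_iff_norm_sub_tendsto_zero]
  have key : Tendsto (fun m => ∑' n, ‖u m n - if a n = 1 then u 0 n else 0‖ ^ (2 : ℝ)) atTop
      (𝓝 (∑' _ : ℤ, (0 : ℝ))) := by
    refine tendsto_tsum_of_dominated_convergence hs (fun n => ?_) (Eventually.of_forall fun m n => ?_)
    · split_ifs with h
      · have e : ∀ m, u m n = u 0 n := fun m => by rw [hu m n, h]; simp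
        simp only [e, sub_self, norm_zero]
        rw [Real.zero_rpow (by norm_num)]
        exact tendsto_const_nhds
      · have : Tendsto (fun m : ℕ => (a n : ℂ) ^ m) atTop (𝓝 0) := by
          apply tendsto_pow_atTop_nhds_zero_of_norm_lt_one
          simpa [abs_of_nonneg (h0 n)] using lt_of_le_of_ne (h1 n) h
        have h2 := ((this.mul_const (u 0 n)).norm).rpow_const (p := 2) (Or.inr (by norm_num))
        simpa [← hu] using h2
    · rw [Real.norm_of_nonneg (by positivity)]
      refine Real.rpow_le_rpow (by positivity) ?_ (by norm_num)
      split_ifs with h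
      · have e : u m n = u 0 n := by rw [hu m n, h]; simp
        simp [e]
      · rw [hu m n, sub_zero, norm_mul, norm_pow, Complex.norm_real, Real.norm_of_nonneg (h0 n)]
        exact mul_le_of_le_one_left (norm_nonneg _) (pow_le_one₀ (h0 n) (h1 n))
  have := key.rpow_const (p := 1/2) (Or.inr (by norm_num))
  simp only [tsum_zero] at this
  rw [Real.zero_rpow (by norm_num)] at this
  refine this.congr fun m => ?_
  rw [lp.norm_eq_tsum_rpow (by norm_num)]
  simp
  rfl

/-- Convergence of the continuous IF iteration on periodic signals: if
`k : AddCircle 1 → ℝ` is continuous and all its Fourier coefficients are real numbers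
in `[0,1]`, and `S : L² → L²` is the operator `S(g) = g − k ⋆ g`, then for every
`g ∈ L²(AddCircle 1)` the iterates `Sᵐ g` converge in `L²`. -/
theorem stmt_14 (k : AddCircle (1 : ℝ) → ℝ) (hk : Continuous k)
    (hcoeff : ∀ n : ℤ, ∃ r : ℝ,
      fourierCoeff (fun x : AddCircle (1 : ℝ) => (k x : ℂ)) n = (r : ℂ) ∧ 0 ≤ r ∧ r ≤ 1)
    (S : Lp ℂ 2 (haarAddCircle : Measure (AddCircle (1 : ℝ))) →
         Lp ℂ 2 (haarAddCircle : Measure (AddCircle (1 : ℝ))))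
    (hS : ∀ g : Lp ℂ 2 (haarAddCircle : Measure (AddCircle (1 : ℝ))),
      ∀ᵐ x ∂(haarAddCircle : Measure (AddCircle (1 : ℝ))),
        (S g) x = g x - ∫ t : AddCircle (1 : ℝ), (k t : ℂ) * g (x - t) ∂haarAddCircle)
    (g : Lp ℂ 2 (haarAddCircle : Measure (AddCircle (1 : ℝ)))) :
    ∃ h : Lp ℂ 2 (haarAddCircle : Measure (AddCircle (1 : ℝ))),
      Tendsto (fun m : ℕ => S^[m] g) atTop (𝓝 h) := by
  choose r hr hr0 hr1 using hcoeff
  have hkc : Continuous fun x : AddCircle (1 : ℝ) => (k x : ℂ) := by fun_prop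
  have hki : Integrable (fun x : AddCircle (1 : ℝ) => (k x : ℂ)) haarAddCircle :=
    hkc.integrable_of_hasCompactSupport (HasCompactSupport.of_compactSpace _)
  have step : ∀ (f : Lp ℂ 2 (haarAddCircle : Measure (AddCircle (1 : ℝ)))) n,
      fourierBasis.repr (S f) n = ((1 - r n : ℝ) : ℂ) * fourierBasis.repr f n := by
    intro f n
    have hf : Integrable f haarAddCircle := (Lp.memLp f).integrable (by norm_num)
    obtain ⟨hi, hc⟩ := aux_conv _ f hki hf n
    rw [fourierBasis_repr, fourierBasis_repr, fourierCoeff_congr_ae (hS f)]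
    have : fourierCoeff (fun x => f x - ∫ t, (k t : ℂ) * f (x - t) ∂haarAddCircle) n
        = fourierCoeff f n - fourierCoeff (fun x => ∫ t, (k t : ℂ) * f (x - t) ∂haarAddCircle) n := by
      simp only [fourierCoeff, smul_sub]
      exact integral_sub (hf.fourier_smul (-n)) (hi.fourier_smul (-n))
    rw [this, hc, hr]
    push_cast
    ring
  obtain ⟨v, hv⟩ := aux_lim (a := fun n => 1 - r n) (fun n => by linarith [hr1 n])
    (fun n => by linarith [hr0 n]) (fun m => fourierBasis.repr (S^[m] g)) (by
      intro m n
      induction m with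
      | zero => simp
      | succ m ih =>
        simp only [Function.iterate_succ', Function.comp_apply] at ih ⊢
        rw [step, ih, pow_succ]
        simp
        ring)
  refine ⟨fourierBasis.repr.symm v, ?_⟩
  have := ((fourierBasis (T := (1 : ℝ))).repr.symm.continuous.tendsto v).comp hv
  simpa [Function.comp_def] using this
end
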